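/- arXiv:1007.2318 — 2 statements merged into one kernel-verified Lean document; each statement's English description precedes it below -/
import Mathlib

section
/- Let r = (r₁,r₂) ∈ ℚ² ∖ ℤ² and let γ = [[a,b],[c,d]] ∈ SL₂(ℤ). Then for every τ in the complex upper half-plane ℍ, g_r^{12}((aτ+b)/(cτ+d)) = g_{rγ}^{12}(τ), where rγ = (r₁a + r₂c, r₁b + r₂d). -/
/-- The Siegel function `g_{(r₁,r₂)}(τ)`, defined by the product expansion
`g_{(r₁,r₂)}(τ) = -q_τ^{B₂(r₁)/2} e^{πi r₂(r₁-1)} (1-q_z) ∏_{n≥1} (1-q_τ^n q_z)(1-q_τ^n q_z⁻¹)`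
where `B₂(X) = X² - X + 1/6`, `q_τ = e^{2πiτ}` and `q_z = e^{2πiz}` with `z = r₁τ + r₂`. -/
noncomputable def siegelG (r : ℚ × ℚ) (τ : ℂ) : ℂ :=
  -Complex.exp (2 * Real.pi * Complex.I * τ * (((r.1 : ℂ) ^ 2 - (r.1 : ℂ) + 1 / 6) / 2)) *
    Complex.exp (Real.pi * Complex.I * (r.2 : ℂ) * ((r.1 : ℂ) - 1)) *
    (1 - Complex.exp (2 * Real.pi * Complex.I * ((r.1 : ℂ) * τ + (r.2 : ℂ)))) *
    ∏' n : ℕ,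
      ((1 - Complex.exp (2 * Real.pi * Complex.I * (((n : ℂ) + 1) * τ + ((r.1 : ℂ) * τ + (r.2 : ℂ))))) *
        (1 - Complex.exp (2 * Real.pi * Complex.I * (((n : ℂ) + 1) * τ - ((r.1 : ℂ) * τ + (r.2 : ℂ))))))

section TripleProduct

open Finset Filter Topology

/-- The finite `q`-Pochhammer symbol `(Q; Q)_m`. -/
noncomputable def qFactorial (Q : ℂ) (m : ℕ) : ℂ := ∏ i ∈ range m, (1 - Q ^ (i + 1))

lemma qFactorial_zero (Q : ℂ) : qFactorial Q 0 = 1 := by simp [qFactorial]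

lemma qFactorial_succ (Q : ℂ) (m : ℕ) :
    qFactorial Q (m + 1) = qFactorial Q m * (1 - Q ^ (m + 1)) := prod_range_succ _ _

lemma one_sub_pow_succ_ne_zero {Q : ℂ} (hQ : ‖Q‖ < 1) (m : ℕ) : 1 - Q ^ (m + 1) ≠ 0 := by
  intro h
  have h1 : ‖Q ^ (m + 1)‖ < 1 := by
    rw [norm_pow]
    exact pow_lt_one₀ (norm_nonneg _) hQ (by simp)
  rw [← sub_eq_zero.mp h, norm_one] at h1
  exact lt_irrefl _ h1

lemma qFactorial_ne_zero {Q : ℂ} (hQ : ‖Q‖ < 1) (m : ℕ) : qFactorial Q m ≠ 0 :=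
  prod_ne_zero_iff.mpr fun i _ ↦ one_sub_pow_succ_ne_zero hQ i

/-- The Gaussian binomial coefficient, for `j ≤ m`. -/
noncomputable def qBinomial (Q : ℂ) (m j : ℕ) : ℂ :=
  qFactorial Q m / (qFactorial Q j * qFactorial Q (m - j))

lemma qBinomial_zero_right {Q : ℂ} (hQ : ‖Q‖ < 1) (m : ℕ) : qBinomial Q m 0 = 1 := by
  simp [qBinomial, qFactorial_zero, qFactorial_ne_zero hQ]

lemma qBinomial_self {Q : ℂ} (hQ : ‖Q‖ < 1) (m : ℕ) : qBinomial Q m m = 1 := by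
  simp [qBinomial, qFactorial_zero, qFactorial_ne_zero hQ]

lemma qBinomial_succ_succ {Q : ℂ} (hQ : ‖Q‖ < 1) {m j : ℕ} (hj : j < m) :
    qBinomial Q (m + 1) (j + 1) = qBinomial Q m (j + 1) + Q ^ (m - j) * qBinomial Q m j := by
  obtain ⟨k, rfl⟩ := Nat.exists_eq_add_of_lt hj
  have h1 : j + k + 1 + 1 - (j + 1) = k + 1 := by omega
  have h2 : j + k + 1 - (j + 1) = k := by omega
  have h3 : j + k + 1 - j = k + 1 := by omega
  simp only [qBinomial, h1, h2, h3, qFactorial_succ]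
  have := qFactorial_ne_zero hQ j
  have := qFactorial_ne_zero hQ k
  have := one_sub_pow_succ_ne_zero hQ j
  have := one_sub_pow_succ_ne_zero hQ k
  field_simp
  ring

/-- Cauchy's `q`-binomial theorem. -/
lemma prod_one_add_mul_pow_eq_sum {Q : ℂ} (hQ : ‖Q‖ < 1) (x : ℂ) (m : ℕ) :
    ∏ k ∈ range m, (1 + x * Q ^ k) =
      ∑ j ∈ range (m + 1), Q ^ (j.choose 2) * qBinomial Q m j * x ^ j := by
  induction m with
  | zero => simp [qBinomial_zero_right hQ]
  | succ m ih =>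
    rw [prod_range_succ, ih, mul_add, mul_one]
    rw [sum_range_succ' _ (m + 1)]
    nth_rw 1 [sum_range_succ']
    rw [sum_range_succ _ m, sum_range_succ _ m, add_mul, sum_mul]
    have h : ∀ j ∈ range m, Q ^ ((j + 1).choose 2) * qBinomial Q (m + 1) (j + 1) * x ^ (j + 1) =
        Q ^ ((j + 1).choose 2) * qBinomial Q m (j + 1) * x ^ (j + 1) +
          Q ^ (j.choose 2) * qBinomial Q m j * x ^ j * (x * Q ^ m) := by
      intro j hj
      have hj' := mem_range.mp hj
      rw [qBinomial_succ_succ hQ hj', Nat.choose_succ_succ' j 1, Nat.choose_one_right]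
      rw [show Q ^ m = Q ^ j * Q ^ (m - j) by rw [← pow_add, Nat.add_sub_cancel' hj'.le]]
      ring
    rw [sum_congr rfl h, sum_add_distrib]
    simp only [qBinomial_zero_right hQ, qBinomial_self hQ, Nat.choose_succ_succ' m 1,
      Nat.choose_one_right]
    ring

lemma prod_pow_two_mul_add_one (q : ℂ) (N : ℕ) :
    ∏ k ∈ range N, q ^ (2 * k + 1) = q ^ (N ^ 2) := by
  induction N with
  | zero => simp
  | succ N ih => rw [prod_range_succ, ih]; ring

/-- The finite form of the Jacobi triple product identity. -/
lemma prod_one_add_mul_one_add_eq_sum {q w : ℂ} (hq : ‖q‖ < 1) (hq0 : q ≠ 0) (hw : w ≠ 0)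
    (N : ℕ) :
    ∏ k ∈ range N, ((1 + w * q ^ (2 * k + 1)) * (1 + w⁻¹ * q ^ (2 * k + 1))) =
      ∑ j ∈ range (2 * N + 1), qBinomial (q ^ 2) (2 * N) j *
        (q ^ (((j : ℤ) - N) ^ 2) * w ^ ((j : ℤ) - N)) := by
  have hQ : ‖q ^ 2‖ < 1 := by
    rw [norm_pow]; exact pow_lt_one₀ (norm_nonneg _) hq two_ne_zero
  have h := prod_one_add_mul_pow_eq_sum hQ (w * q ^ (1 - 2 * (N : ℤ))) (2 * N)
  have hupper (k : ℕ) : 1 + w * q ^ (1 - 2 * (N : ℤ)) * (q ^ 2) ^ (N + k) =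
      1 + w * q ^ (2 * k + 1) := by
    rw [mul_assoc, ← zpow_natCast, ← zpow_natCast, ← zpow_natCast, ← zpow_mul, ← zpow_add₀ hq0]
    congr 3
    push_cast
    ring
  have hlower (k : ℕ) (hk : k ∈ range N) :
      1 + w * q ^ (1 - 2 * (N : ℤ)) * (q ^ 2) ^ (N - 1 - k) =
      (w * (q ^ (2 * k + 1))⁻¹) * (1 + w⁻¹ * q ^ (2 * k + 1)) := by
    have hk' := mem_range.mp hk
    have : q ^ (1 - 2 * (N : ℤ)) * (q ^ 2) ^ (N - 1 - k) = (q ^ (2 * k + 1))⁻¹ := by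
      rw [← zpow_natCast, ← zpow_natCast, ← zpow_natCast, ← zpow_mul, ← zpow_add₀ hq0, ← zpow_neg]
      congr 1
      push_cast [Nat.sub_sub, Nat.cast_sub (show 1 + k ≤ N by omega)]
      ring
    rw [mul_assoc, this]
    field_simp
    ring
  rw [two_mul N, prod_range_add, prod_congr rfl fun k _ ↦ hupper k, ← prod_range_reflect,
    prod_congr rfl hlower, prod_mul_distrib, prod_mul_distrib, prod_inv_distrib,
    prod_pow_two_mul_add_one, prod_const, card_range, ← two_mul] at h
  have hfactor : (∏ k ∈ range N, (1 + w * q ^ (2 * k + 1))) *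
      (∏ k ∈ range N, (1 + w⁻¹ * q ^ (2 * k + 1))) = q ^ (N ^ 2) * (w ^ N)⁻¹ *
      ((w ^ N * (q ^ N ^ 2)⁻¹ * ∏ k ∈ range N, (1 + w⁻¹ * q ^ (2 * k + 1))) *
        ∏ k ∈ range N, (1 + w * q ^ (2 * k + 1))) := by
    generalize ∏ k ∈ range N, (1 + w⁻¹ * q ^ (2 * k + 1)) = A
    generalize ∏ k ∈ range N, (1 + w * q ^ (2 * k + 1)) = B
    field_simp
  rw [prod_mul_distrib, hfactor, h, mul_sum]
  refine sum_congr rfl fun j _ ↦ ?_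
  have hc : (q ^ 2) ^ (j.choose 2) = q ^ ((j : ℤ) ^ 2 - j) := by
    rw [← pow_mul, ← zpow_natCast]
    congr 1
    rw [mul_comm, Nat.choose_two_right, Nat.div_mul_cancel (Nat.even_mul_pred_self j).two_dvd]
    rcases j with _ | j
    · simp
    · push_cast [Nat.add_sub_cancel]
      ring
  rw [hc, mul_pow, ← zpow_natCast (q ^ (1 - 2 * (N : ℤ))), ← zpow_mul, zpow_sub₀ hw, zpow_natCast w,
    zpow_natCast w]
  have : q ^ (((j : ℤ) - N) ^ 2) =
      q ^ ((N ^ 2 : ℕ) : ℤ) * q ^ ((j : ℤ) ^ 2 - j) * q ^ ((1 - 2 * (N : ℤ)) * j) := by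
    rw [← zpow_add₀ hq0, ← zpow_add₀ hq0]
    congr 1
    push_cast
    ring
  rw [this, zpow_natCast]
  field_simp

/-- The coefficient of `q ^ n ^ 2 * w ^ n` in the finite triple product, extended by zero. -/
noncomputable def tripleCoeff (Q : ℂ) (N : ℕ) (n : ℤ) : ℂ :=
  if n ∈ Icc (-(N : ℤ)) N then
    qFactorial Q (2 * N) / (qFactorial Q (N + n).toNat * qFactorial Q (N - n).toNat) else 0

lemma sum_qBinomial_eq_tsum_tripleCoeff (Q : ℂ) (f : ℤ → ℂ) (N : ℕ) :
    ∑ j ∈ range (2 * N + 1), qBinomial Q (2 * N) j * f ((j : ℤ) - N) =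
      ∑' n : ℤ, tripleCoeff Q N n * f n := by
  rw [tsum_eq_sum (s := Icc (-(N : ℤ)) N)
    fun n hn ↦ by simp only [tripleCoeff, if_neg hn, zero_mul]]
  refine sum_bij (fun j _ ↦ (j : ℤ) - N) ?_ ?_ ?_ ?_
  · intro j hj
    simp only [mem_range, mem_Icc] at hj ⊢
    omega
  · intro a _ b _ h
    simpa using h
  · intro n hn
    simp only [mem_Icc] at hn
    exact ⟨(n + N).toNat, by simp only [mem_range]; omega, by omega⟩
  · intro j hj
    simp only [mem_range] at hj
    rw [tripleCoeff, if_pos (by simp only [mem_Icc]; omega), qBinomial]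
    congr 4
    · omega
    · omega

lemma tendsto_qFactorial {Q : ℂ} (hQ : ‖Q‖ < 1) :
    Tendsto (qFactorial Q) atTop (𝓝 (∏' n : ℕ, (1 - Q ^ (n + 1)))) :=
  (ModularForm.multipliable_one_sub_pow hQ).tendsto_prod_tprod_nat

lemma tprod_one_sub_pow_ne_zero {Q : ℂ} (hQ : ‖Q‖ < 1) : ∏' n : ℕ, (1 - Q ^ (n + 1)) ≠ 0 := by
  simp_rw [sub_eq_add_neg]
  refine tprod_one_add_ne_zero_of_summable
    (fun i ↦ by simpa [sub_eq_add_neg] using one_sub_pow_succ_ne_zero hQ i) ?_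
  simpa using (summable_nat_add_iff 1).mpr (summable_geometric_of_lt_one (norm_nonneg _) hQ)

lemma tendsto_tripleCoeff {Q : ℂ} (hQ : ‖Q‖ < 1) (n : ℤ) :
    Tendsto (fun N ↦ tripleCoeff Q N n) atTop (𝓝 (∏' n : ℕ, (1 - Q ^ (n + 1)))⁻¹) := by
  have hP := tendsto_qFactorial hQ
  have h0 := tprod_one_sub_pow_ne_zero hQ
  have h1 : Tendsto (fun N : ℕ ↦ 2 * N) atTop atTop :=
    tendsto_id.const_mul_atTop' two_pos
  have h2 : Tendsto (fun N : ℕ ↦ ((N : ℤ) + n).toNat) atTop atTop :=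
    tendsto_atTop.mpr fun b ↦ eventually_atTop.mpr ⟨b + n.natAbs, fun N hN ↦ by omega⟩
  have h3 : Tendsto (fun N : ℕ ↦ ((N : ℤ) - n).toNat) atTop atTop :=
    tendsto_atTop.mpr fun b ↦ eventually_atTop.mpr ⟨b + n.natAbs, fun N hN ↦ by omega⟩
  have := (hP.comp h1).div ((hP.comp h2).mul (hP.comp h3)) (mul_ne_zero h0 h0)
  rw [div_mul_cancel_left₀ h0] at this
  refine this.congr' ?_
  filter_upwards [eventually_ge_atTop n.natAbs] with N hN
  rw [tripleCoeff, if_pos (by simp only [mem_Icc]; omega)]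
  rfl

lemma exists_norm_tripleCoeff_le {Q : ℂ} (hQ : ‖Q‖ < 1) :
    ∃ C : ℝ, ∀ (N : ℕ) (n : ℤ), ‖tripleCoeff Q N n‖ ≤ C := by
  have hP := tendsto_qFactorial hQ
  have h0 := tprod_one_sub_pow_ne_zero hQ
  obtain ⟨A, hA⟩ := hP.norm.bddAbove_range
  obtain ⟨B, hB⟩ := (hP.inv₀ h0).norm.bddAbove_range
  have hA' (m : ℕ) : ‖qFactorial Q m‖ ≤ A := hA ⟨m, rfl⟩
  have hB' (m : ℕ) : ‖(qFactorial Q m)⁻¹‖ ≤ B := hB ⟨m, rfl⟩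
  have hA0 : 0 ≤ A := (norm_nonneg _).trans (hA' 0)
  have hB0 : 0 ≤ B := (norm_nonneg _).trans (hB' 0)
  refine ⟨A * (B * B), fun N n ↦ ?_⟩
  rw [tripleCoeff]
  split_ifs
  · rw [div_eq_mul_inv, mul_inv, norm_mul, norm_mul]
    gcongr
    exacts [hA' _, hB' _, hB' _]
  · rw [norm_zero]
    positivity

lemma multipliable_one_add_mul_pow {q : ℂ} (hq : ‖q‖ < 1) (w : ℂ) :
    Multipliable fun k : ℕ ↦ 1 + w * q ^ k := by
  refine multipliable_one_add_of_summable ?_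
  simpa using (summable_geometric_of_lt_one (norm_nonneg _) hq).mul_left ‖w‖

/-- The Jacobi triple product identity. -/
theorem jacobi_triple_product {q w : ℂ} (hq : ‖q‖ < 1) (hq0 : q ≠ 0) (hw : w ≠ 0)
    (hsum : Summable fun n : ℤ ↦ q ^ (n ^ 2) * w ^ n) :
    ∑' n : ℤ, q ^ (n ^ 2) * w ^ n =
      (∏' n : ℕ, (1 - (q ^ 2) ^ (n + 1))) *
        ∏' k : ℕ, ((1 + w * q ^ (2 * k + 1)) * (1 + w⁻¹ * q ^ (2 * k + 1))) := by
  have hQ : ‖q ^ 2‖ < 1 := by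
    rw [norm_pow]; exact pow_lt_one₀ (norm_nonneg _) hq two_ne_zero
  have hmult (w : ℂ) : Multipliable fun k : ℕ ↦ 1 + w * q ^ (2 * k + 1) := by
    convert multipliable_one_add_mul_pow hQ (w * q) using 3 with k
    ring
  have hprod := ((hmult w).mul (hmult w⁻¹)).tendsto_prod_tprod_nat
  obtain ⟨C, hC⟩ := exists_norm_tripleCoeff_le hQ
  have hlim := tendsto_tsum_of_dominated_convergence (hsum.norm.mul_left C)
    (fun n ↦ (tendsto_tripleCoeff hQ n).mul_const (q ^ (n ^ 2) * w ^ n))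
    (Eventually.of_forall fun N n ↦ by
      rw [norm_mul]
      exact mul_le_mul_of_nonneg_right (hC N n) (norm_nonneg _))
  have heq := tendsto_nhds_unique (hlim.congr fun N ↦ by
    rw [← sum_qBinomial_eq_tsum_tripleCoeff, ← prod_one_add_mul_one_add_eq_sum hq hq0 hw]) hprod
  rw [← heq, tsum_mul_left, mul_inv_cancel_left₀ (tprod_one_sub_pow_ne_zero hQ)]

end TripleProduct

section SiegelFunction

open Complex Real ModularForm

lemma norm_cexp_pi_mul_I_mul_lt_one {τ : ℂ} (hτ : 0 < τ.im) : ‖cexp (π * I * τ)‖ < 1 := by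
  rw [Complex.norm_exp, Real.exp_lt_one_iff]
  simpa using mul_pos pi_pos hτ

/-- The product expansion of the Jacobi theta function, in the normalization of the Siegel
function. -/
lemma jacobiTheta₂_eq_tprod (z : ℂ) {τ : ℂ} (hτ : 0 < τ.im) :
    jacobiTheta₂ (z - τ / 2 + 1 / 2) τ = (∏' n, (1 - eta_q n τ)) * ((1 - cexp (2 * π * I * z)) *
      ∏' n : ℕ, ((1 - cexp (2 * π * I * ((n + 1) * τ + z))) *
        (1 - cexp (2 * π * I * ((n + 1) * τ - z))))) := by
  have hq := norm_cexp_pi_mul_I_mul_lt_one hτ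
  have hQ : cexp (π * I * τ) ^ 2 = cexp (2 * π * I * τ) := by
    rw [← Complex.exp_nat_mul]
    ring_nf
  have hQ1 : ‖cexp (2 * π * I * τ)‖ < 1 := by
    rw [← hQ, norm_pow]
    exact pow_lt_one₀ (norm_nonneg _) hq two_ne_zero
  have hterm (n : ℤ) : jacobiTheta₂_term n (z - τ / 2 + 1 / 2) τ =
      cexp (π * I * τ) ^ (n ^ 2) * cexp (2 * π * I * (z - τ / 2 + 1 / 2)) ^ n := by
    rw [jacobiTheta₂_term, ← Complex.exp_int_mul, ← Complex.exp_int_mul, ← Complex.exp_add]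
    congr 1
    push_cast
    ring
  have hsum := (summable_jacobiTheta₂_term_iff (z - τ / 2 + 1 / 2) τ).mpr hτ
  simp_rw [hterm] at hsum
  have hplus (k : ℕ) : 1 + cexp (2 * π * I * (z - τ / 2 + 1 / 2)) * cexp (π * I * τ) ^ (2 * k + 1) =
      1 - cexp (2 * π * I * (k * τ + z)) := by
    rw [← Complex.exp_nat_mul, ← Complex.exp_add, sub_eq_add_neg (1 : ℂ) (cexp _),
      ← Complex.exp_add_pi_mul_I]
    congr 2
    push_cast
    ring
  have hminus (k : ℕ) :
      1 + (cexp (2 * π * I * (z - τ / 2 + 1 / 2)))⁻¹ * cexp (π * I * τ) ^ (2 * k + 1) =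
      1 - cexp (2 * π * I * ((k + 1) * τ - z)) := by
    rw [← Complex.exp_nat_mul, ← Complex.exp_neg, ← Complex.exp_add,
      sub_eq_add_neg (1 : ℂ) (cexp _), ← Complex.exp_sub_pi_mul_I]
    congr 2
    push_cast
    ring
  have hmult (c : ℂ) : Multipliable fun k : ℕ ↦ 1 - cexp (2 * π * I * (k * τ + c)) := by
    convert multipliable_one_add_mul_pow hQ1 (-cexp (2 * π * I * c)) using 3 with k
    rw [← Complex.exp_nat_mul, neg_mul, ← Complex.exp_add, sub_eq_add_neg]
    ring_nf
  have hmult1 : Multipliable fun k : ℕ ↦ 1 - cexp (2 * π * I * ((k + 1) * τ + z)) := by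
    convert hmult (τ + z) using 5
    ring
  have hmult2 : Multipliable fun k : ℕ ↦ 1 - cexp (2 * π * I * ((k + 1) * τ - z)) := by
    convert hmult (τ - z) using 5
    ring
  have hsplit : ∏' k : ℕ, (1 - cexp (2 * π * I * (k * τ + z))) = (1 - cexp (2 * π * I * z)) *
      ∏' k : ℕ, (1 - cexp (2 * π * I * ((k + 1) * τ + z))) := by
    rw [tprod_eq_zero_mul' (by simpa using hmult1)]
    simp
  rw [jacobiTheta₂]
  simp_rw [hterm]
  rw [jacobi_triple_product hq (Complex.exp_ne_zero _) (Complex.exp_ne_zero _) hsum, hQ]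
  simp_rw [hplus, hminus, eta_q_eq_pow]
  rw [(hmult z).tprod_mul hmult2, hmult1.tprod_mul hmult2, hsplit, mul_assoc (1 - cexp _)]

/-- The Siegel function times the Dedekind eta function is, up to an exponential factor, a value of
the Jacobi theta function. -/
lemma siegelG_mul_eta (r₁ r₂ : ℚ) {τ : ℂ} (hτ : 0 < τ.im) :
    siegelG (r₁, r₂) τ * ModularForm.eta τ =
      -cexp (π * I * (τ * (r₁ - 1 / 2) ^ 2 + r₂ * (r₁ - 1))) *
        jacobiTheta₂ ((r₁ - 1 / 2) * τ + r₂ + 1 / 2) τ := by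
  have hz : ((r₁ : ℂ) - 1 / 2) * τ + r₂ + 1 / 2 = (r₁ * τ + r₂) - τ / 2 + 1 / 2 := by ring
  have he : cexp (π * I * (τ * (r₁ - 1 / 2) ^ 2 + r₂ * (r₁ - 1))) =
      cexp (2 * π * I * τ * (((r₁ : ℂ) ^ 2 - r₁ + 1 / 6) / 2)) * cexp (π * I * r₂ * (r₁ - 1)) *
        Function.Periodic.qParam 24 τ := by
    rw [Function.Periodic.qParam, ← Complex.exp_add, ← Complex.exp_add]
    congr 1
    push_cast
    ring
  rw [hz, jacobiTheta₂_eq_tprod _ hτ, he, siegelG, ModularForm.eta]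
  ring

lemma eta_neg_one_div_pow_twelve {τ : ℂ} (hτ : 0 < τ.im) :
    ModularForm.eta (-1 / τ) ^ 12 = -(τ ^ 6 * ModularForm.eta τ ^ 12) := by
  have hsqrt {z : ℂ} (hz : z ≠ 0) : Complex.sqrt z ^ 12 = z ^ 6 := by
    rw [sqrt_eq_exp hz, ← Complex.exp_nat_mul]
    conv_rhs => rw [← Complex.exp_log hz, ← Complex.exp_nat_mul]
    congr 1
    push_cast
    ring
  have hτ0 : τ ≠ 0 := by rintro rfl; simp at hτ
  have h : ModularForm.eta (-1 / τ) = (Complex.sqrt I)⁻¹ * (Complex.sqrt τ * ModularForm.eta τ) :=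
    eta_comp_eq_csqrt_I_inv hτ
  have hI : I ^ 6 = -1 := by rw [show 6 = 4 + 2 by rfl, pow_add, I_pow_four, I_sq, one_mul]
  rw [h, mul_pow, mul_pow, inv_pow, hsqrt I_ne_zero, hsqrt hτ0, hI]
  norm_num

/-- The transformation formula of the Siegel function under `S : τ ↦ -1 / τ`. -/
lemma siegelG_neg_one_div_pow_twelve (r₁ r₂ : ℚ) {τ : ℂ} (hτ : 0 < τ.im) :
    siegelG (r₁, r₂) (-1 / τ) ^ 12 = siegelG (r₂, -r₁) τ ^ 12 := by
  have hτ0 : τ ≠ 0 := by rintro rfl; simp at hτ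
  have hS : 0 < (-1 / τ).im := by
    rw [neg_div, neg_im, one_div, inv_im, neg_div, neg_neg]
    exact div_pos hτ (normSq_pos.mpr hτ0)
  have hη : ModularForm.eta τ ^ 12 ≠ 0 := pow_ne_zero _ (eta_ne_zero hτ)
  have h6 : (1 / (-I * τ) ^ (1 / 2 : ℂ)) ^ 12 * τ ^ 6 = -1 := by
    have : ((-I * τ) ^ (1 / 2 : ℂ)) ^ 12 = (-I * τ) ^ 6 := by
      rw [← cpow_nat_mul, ← cpow_natCast]
      norm_num
    have hI : I ^ 6 = -1 := by rw [show 6 = 4 + 2 by rfl, pow_add, I_pow_four, I_sq, one_mul]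
    rw [div_pow, this, mul_pow, neg_pow, hI]
    field_simp
  have h1 := congrArg (· ^ 12) (siegelG_mul_eta r₁ r₂ hS)
  have h2 := congrArg (· ^ 12) (siegelG_mul_eta r₂ (-r₁) hτ)
  have hshift := jacobiTheta₂_add_left' (((r₂ : ℂ) - 1 / 2) * τ + (-r₁ : ℚ) + 1 / 2) τ
  rw [jacobiTheta₂_functional_equation] at hshift
  have harg : ((r₂ - 1 / 2) * τ + (-r₁ : ℚ) + 1 / 2 + τ) / τ =
      (r₁ - 1 / 2) * (-1 / τ) + r₂ + 1 / 2 := by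
    field_simp
    push_cast
    ring
  rw [harg] at hshift
  have hshift' := congrArg (· ^ 12) hshift
  simp only [mul_pow] at h1 h2 hshift'
  rw [eta_neg_one_div_pow_twelve hτ, Even.neg_pow (by decide)] at h1
  rw [Even.neg_pow (by decide)] at h2
  have hexp : cexp (π * I * (τ * (r₂ - 1 / 2) ^ 2 + (-r₁ : ℚ) * (r₂ - 1))) ^ 12 *
      cexp (-π * I * ((r₂ - 1 / 2) * τ + (-r₁ : ℚ) + 1 / 2 + τ) ^ 2 / τ) ^ 12 =
      cexp (-π * I * (τ + 2 * ((r₂ - 1 / 2) * τ + (-r₁ : ℚ) + 1 / 2))) ^ 12 *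
        cexp (π * I * (-1 / τ * (r₁ - 1 / 2) ^ 2 + r₂ * (r₁ - 1))) ^ 12 := by
    simp only [← Complex.exp_nat_mul, ← Complex.exp_add]
    rw [Complex.exp_eq_exp_iff_exists_int]
    refine ⟨3, ?_⟩
    push_cast
    field_simp
    ring
  have hE₄ := pow_ne_zero 12 (Complex.exp_ne_zero
    (-π * I * (τ + 2 * ((r₂ - 1 / 2) * τ + (-r₁ : ℚ) + 1 / 2))))
  have cancel {g₁ g₂ e t A θ₁ θ₂ E₁ E₂ E₃ E₄ : ℂ} (he : e ≠ 0) (hE₄ : E₄ ≠ 0)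
      (h₁ : g₁ * -(t * e) = E₁ * θ₁) (h₂ : g₂ * e = E₂ * θ₂) (h₃ : A * E₃ * θ₁ = E₄ * θ₂)
      (hE : E₂ * E₃ = E₄ * E₁) (hA : A * t = -1) : g₁ = g₂ := by
    refine mul_right_cancel₀ (mul_ne_zero he hE₄) ?_
    linear_combination -E₄ * h₂ + E₂ * h₃ - A * θ₁ * hE + A * E₄ * h₁ + E₄ * g₁ * e * hA
  exact cancel hη hE₄ h1 h2 hshift' hexp h6

lemma siegelG_add_one_pow_twelve (r₁ r₂ : ℚ) (τ : ℂ) :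
    siegelG (r₁, r₂) (τ + 1) ^ 12 = siegelG (r₁, r₁ + r₂) τ ^ 12 := by
  have hexp (w : ℂ) (n : ℤ) (w' : ℂ) (h : w = w' + n) :
      cexp (2 * π * I * w) = cexp (2 * π * I * w') := by
    rw [Complex.exp_eq_exp_iff_exists_int]
    exact ⟨n, by rw [h]; ring⟩
  have h0 : cexp (2 * π * I * (r₁ * (τ + 1) + r₂)) =
      cexp (2 * π * I * (r₁ * τ + (r₁ + r₂ : ℚ))) := hexp _ 0 _ (by push_cast; ring)
  have hplus (n : ℕ) : cexp (2 * π * I * ((n + 1) * (τ + 1) + (r₁ * (τ + 1) + r₂))) =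
      cexp (2 * π * I * ((n + 1) * τ + (r₁ * τ + (r₁ + r₂ : ℚ)))) :=
    hexp _ (n + 1) _ (by push_cast; ring)
  have hminus (n : ℕ) : cexp (2 * π * I * ((n + 1) * (τ + 1) - (r₁ * (τ + 1) + r₂))) =
      cexp (2 * π * I * ((n + 1) * τ - (r₁ * τ + (r₁ + r₂ : ℚ)))) :=
    hexp _ (n + 1) _ (by push_cast; ring)
  have hfactor : cexp (2 * π * I * (τ + 1) * (((r₁ : ℂ) ^ 2 - r₁ + 1 / 6) / 2)) ^ 12 *
      cexp (π * I * r₂ * (r₁ - 1)) ^ 12 =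
      cexp (2 * π * I * τ * (((r₁ : ℂ) ^ 2 - r₁ + 1 / 6) / 2)) ^ 12 *
        cexp (π * I * (r₁ + r₂ : ℚ) * (r₁ - 1)) ^ 12 := by
    simp only [← Complex.exp_nat_mul, ← Complex.exp_add]
    rw [Complex.exp_eq_exp_iff_exists_int]
    refine ⟨1, ?_⟩
    push_cast
    ring
  simp only [siegelG, h0, hplus, hminus, mul_pow, Even.neg_pow (by decide : Even 12), hfactor]

open UpperHalfPlane MatrixGroups in
lemma siegelG_smul_pow_twelve (γ : SL(2, ℤ)) (r₁ r₂ : ℚ) (τ : ℍ) :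
    siegelG (r₁, r₂) ((γ • τ : ℍ) : ℂ) ^ 12 =
      siegelG (r₁ * (γ 0 0 : ℤ) + r₂ * (γ 1 0 : ℤ), r₁ * (γ 0 1 : ℤ) + r₂ * (γ 1 1 : ℤ)) τ ^ 12 := by
  have hγ : γ ∈ Subgroup.closure {ModularGroup.S, ModularGroup.T} := by
    simp [SpecialLinearGroup.SL2Z_generators]
  induction hγ using Subgroup.closure_induction generalizing r₁ r₂ τ with
  | mem γ hγ =>
    rcases hγ with rfl | rfl
    · rw [modular_S_smul]
      simpa [ModularGroup.S, neg_div] using siegelG_neg_one_div_pow_twelve r₁ r₂ τ.im_pos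
    · rw [modular_T_smul]
      simpa [ModularGroup.T, add_comm] using siegelG_add_one_pow_twelve r₁ r₂ τ
  | one => simp
  | mul γ δ _ _ hγ hδ =>
    rw [mul_smul, hγ, hδ]
    simp only [Matrix.SpecialLinearGroup.coe_mul, Matrix.mul_apply, Fin.sum_univ_two]
    push_cast
    ring_nf
  | inv γ _ hγ =>
    have h := hγ (r₁ * (γ⁻¹ 0 0 : ℤ) + r₂ * (γ⁻¹ 1 0 : ℤ))
      (r₁ * (γ⁻¹ 0 1 : ℤ) + r₂ * (γ⁻¹ 1 1 : ℤ)) (γ⁻¹ • τ)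
    rw [smul_inv_smul] at h
    rw [h]
    have hdet : (γ 0 0 : ℚ) * γ 1 1 - γ 0 1 * γ 1 0 = 1 := by
      exact_mod_cast (Matrix.det_fin_two _).symm.trans γ.det_coe
    congr 3
    · simp [Matrix.SpecialLinearGroup.SL2_inv_expl]
      linear_combination (-r₁) * hdet
    · simp [Matrix.SpecialLinearGroup.SL2_inv_expl]
      linear_combination (-r₂) * hdet

end SiegelFunction

/-- For `r = (r₁,r₂) ∈ ℚ² \ ℤ²`, `γ = [[a,b],[c,d]] ∈ SL₂(ℤ)` and `τ ∈ ℍ`,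
`g_r^{12}((aτ+b)/(cτ+d)) = g_{rγ}^{12}(τ)` where `rγ = (r₁a + r₂c, r₁b + r₂d)`. -/
theorem siegelG_pow_twelve_sl2 (r₁ r₂ : ℚ)
    (hr : ¬((∃ a : ℤ, (a : ℚ) = r₁) ∧ (∃ b : ℤ, (b : ℚ) = r₂)))
    (γ : Matrix.SpecialLinearGroup (Fin 2) ℤ) (τ : UpperHalfPlane) :
    siegelG (r₁, r₂)
        ((((γ 0 0 : ℤ) : ℂ) * (τ : ℂ) + ((γ 0 1 : ℤ) : ℂ)) /
          (((γ 1 0 : ℤ) : ℂ) * (τ : ℂ) + ((γ 1 1 : ℤ) : ℂ))) ^ 12 =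
      siegelG (r₁ * ((γ 0 0 : ℤ) : ℚ) + r₂ * ((γ 1 0 : ℤ) : ℚ),
          r₁ * ((γ 0 1 : ℤ) : ℚ) + r₂ * ((γ 1 1 : ℤ) : ℚ)) (τ : ℂ) ^ 12 := by
  have h := siegelG_smul_pow_twelve γ r₁ r₂ τ
  rw [UpperHalfPlane.coe_specialLinearGroup_apply] at h
  simpa using h
end

section
/- Let L ⊆ F be subfields of ℂ with F/L a finite abelian Galois extension with Galois group G = {γ₁, ..., γ_n}. For an element x ∈ F, the conjugates {γ(x) : γ ∈ G} form a normal basis of F over L if and only if Σ_{k=1}^n χ(γ_k⁻¹) γ_k(x) ≠ 0 for every character χ : G → ℂˣ. -/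
set_option synthInstance.maxHeartbeats 1000000
set_option maxHeartbeats 1000000

/-- A function on a finite abelian group is zero if its sum against every character vanishes. -/
theorem eq_zero_of_forall_sum_mul_character_eq_zero {G : Type*} [CommGroup G] [Fintype G]
    (a : G → ℂ) (h : ∀ χ : G →* ℂˣ, ∑ g, a g * (χ g : ℂ) = 0) : a = 0 := by
  let ev : G → ((G →* ℂˣ) →* ℂ) := fun g => (Units.coeHom ℂ).comp (MonoidHom.eval g)
  have hev : Function.Injective ev := by
    intro g₁ g₂ h₁₂
    by_contra hne
    obtain ⟨χ, hχ⟩ := CommGroup.exists_apply_ne_one_of_hasEnoughRootsOfUnity G ℂ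
      (a := g₁ * g₂⁻¹) (by rwa [Ne, mul_inv_eq_one])
    apply hχ
    rw [map_mul, map_inv, mul_inv_eq_one]
    exact Units.ext (DFunLike.congr_fun h₁₂ χ)
  have hli := (linearIndependent_monoidHom (G →* ℂˣ) ℂ).comp ev hev
  rw [Fintype.linearIndependent_iff] at hli
  funext g
  refine hli a ?_ g
  funext χ
  simpa [ev, Finset.sum_apply] using h χ

/-- If all character sums of `f` are nonzero, then convolution with `f` is injective. -/
theorem eq_zero_of_forall_sum_mul_translate_eq_zero {G : Type*} [CommGroup G] [Fintype G]
    (f a : G → ℂ) (hf : ∀ χ : G →* ℂˣ, ∑ g, ((χ g⁻¹ : ℂˣ) : ℂ) * f g ≠ 0)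
    (h : ∀ t, ∑ g, a g * f (t * g) = 0) : a = 0 := by
  refine eq_zero_of_forall_sum_mul_character_eq_zero a fun χ => ?_
  refine (mul_eq_zero.mp ?_).resolve_right (hf χ)
  calc (∑ g, a g * (χ g : ℂ)) * ∑ t, ((χ t⁻¹ : ℂˣ) : ℂ) * f t
      = ∑ g, ∑ t, ((χ t⁻¹ : ℂˣ) : ℂ) * (a g * f (t * g)) := by
        rw [Finset.sum_mul]
        refine Finset.sum_congr rfl fun g _ => ?_
        rw [← Equiv.sum_comp (Equiv.mulRight g), Finset.mul_sum]
        refine Finset.sum_congr rfl fun t _ => ?_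
        have hχ : (χ g : ℂ) * ((χ (t * g)⁻¹ : ℂˣ) : ℂ) = ((χ t⁻¹ : ℂˣ) : ℂ) := by
          rw [← Units.val_mul, ← map_mul, mul_inv_rev, mul_inv_cancel_left]
        rw [← hχ, Equiv.coe_mulRight]
        ring
    _ = ∑ t, ((χ t⁻¹ : ℂˣ) : ℂ) * ∑ g, a g * f (t * g) := by
        rw [Finset.sum_comm]
        simp only [Finset.mul_sum]
    _ = 0 := by simp only [h, mul_zero, Finset.sum_const_zero]

/-- Automorphisms of an intermediate field `F` of `K / L` are linearly independent over `K`. -/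
theorem eq_zero_of_forall_sum_mul_algEquiv_eq_zero {L K : Type*} [Field L] [Field K] [Algebra L K]
    (F : IntermediateField L K) [Fintype (F ≃ₐ[L] F)] (c : (F ≃ₐ[L] F) → K)
    (h : ∀ y : F, ∑ σ, c σ * (σ y : K) = 0) : c = 0 := by
  let ev : (F ≃ₐ[L] F) → (F →* K) := fun σ => (F.val.comp σ.toAlgHom : F →* K)
  have hev : Function.Injective ev := fun σ τ hστ =>
    AlgEquiv.ext fun y => Subtype.ext (DFunLike.congr_fun hστ y)
  have hli := (linearIndependent_monoidHom F K).comp ev hev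
  rw [Fintype.linearIndependent_iff] at hli
  funext σ
  refine hli c ?_ σ
  funext y
  simpa [ev, Finset.sum_apply] using h y

/-- Let `L ⊆ F` be subfields of `ℂ` with `F/L` a finite abelian Galois extension with Galois
group `G = {γ₁, ..., γₙ}`. The conjugates of `x ∈ F` form a normal basis of `F` over `L` iff
`∑_{k=1}^n χ(γ_k⁻¹) γ_k(x) ≠ 0` for every character `χ : G → ℂˣ`. -/
theorem normal_basis_iff_character_sums_ne_zero (L : Subfield ℂ) (F : IntermediateField L ℂ)
    [FiniteDimensional L F] [IsGalois L F]
    (hab : ∀ σ τ : F ≃ₐ[L] F, σ * τ = τ * σ)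
    (n : ℕ) (γ : Fin n → (F ≃ₐ[L] F)) (hγ : Function.Bijective γ) (x : F) :
    (LinearIndependent L (fun σ : F ≃ₐ[L] F => σ x) ∧
        Submodule.span L (Set.range fun σ : F ≃ₐ[L] F => σ x) = ⊤) ↔
      ∀ χ : (F ≃ₐ[L] F) →* ℂˣ,
        (∑ k : Fin n, ((χ ((γ k)⁻¹) : ℂˣ) : ℂ) * ((γ k) x : ℂ)) ≠ 0 := by
  let _ : CommGroup (F ≃ₐ[L] F) := { (inferInstance : Group (F ≃ₐ[L] F)) with mul_comm := hab }
  let _ : Fintype (F ≃ₐ[L] F) := Fintype.ofFinite _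
  have hsum (χ : (F ≃ₐ[L] F) →* ℂˣ) :
      ∑ k : Fin n, ((χ ((γ k)⁻¹) : ℂˣ) : ℂ) * ((γ k) x : ℂ) =
        ∑ σ, ((χ σ⁻¹ : ℂˣ) : ℂ) * (σ x : ℂ) :=
    hγ.sum_comp fun σ : F ≃ₐ[L] F => ((χ σ⁻¹ : ℂˣ) : ℂ) * (σ x : ℂ)
  simp only [hsum]
  have hsmul (σ : F ≃ₐ[L] F) (a : L) (y : F) :
      ((σ (a • y) : F) : ℂ) = (a : ℂ) * (σ y : ℂ) :=
    congrArg Subtype.val (σ.toLinearMap.map_smul a y)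
  constructor
  · rintro ⟨-, hspan⟩ χ hχ
    have hconj (τ : F ≃ₐ[L] F) : ∑ σ, ((χ σ⁻¹ : ℂˣ) : ℂ) * (σ (τ x) : ℂ) = 0 := by
      have hmul : ((χ τ⁻¹ : ℂˣ) : ℂ) * ∑ σ, ((χ σ⁻¹ : ℂˣ) : ℂ) * (σ (τ x) : ℂ) = 0 := by
        rw [← hχ, ← Equiv.sum_comp (Equiv.mulRight τ) fun σ => ((χ σ⁻¹ : ℂˣ) : ℂ) * (σ x : ℂ),
          Finset.mul_sum]
        refine Finset.sum_congr rfl fun σ _ => ?_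
        rw [Equiv.coe_mulRight, mul_inv_rev, map_mul, Units.val_mul, AlgEquiv.mul_apply, mul_assoc]
      exact (mul_eq_zero.mp hmul).resolve_left (Units.ne_zero _)
    have hzero := eq_zero_of_forall_sum_mul_algEquiv_eq_zero F
      (fun σ => ((χ σ⁻¹ : ℂˣ) : ℂ)) fun y => by
        have hy : y ∈ Submodule.span L (Set.range fun σ : F ≃ₐ[L] F => σ x) :=
          hspan ▸ Submodule.mem_top
        induction hy using Submodule.span_induction with
        | mem y hy =>
          obtain ⟨τ, rfl⟩ := hy
          exact hconj τ
        | zero => simp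
        | add y z _ _ hy hz =>
          simp only [map_add, IntermediateField.coe_add, mul_add, Finset.sum_add_distrib, hy, hz,
            add_zero]
        | smul a y _ hy =>
          simp only [hsmul, mul_left_comm _ (a : ℂ), ← Finset.mul_sum, hy, mul_zero]
    exact Units.ne_zero _ (congrFun hzero 1)
  · intro hχ
    have hli : LinearIndependent L (fun σ : F ≃ₐ[L] F => σ x) := by
      rw [Fintype.linearIndependent_iff]
      intro a ha σ
      have hzero := eq_zero_of_forall_sum_mul_translate_eq_zero
        (fun σ : F ≃ₐ[L] F => (σ x : ℂ)) (fun σ => (a σ : ℂ)) hχ fun τ => by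
          have hτ := congrArg (fun y : F => (τ y : ℂ)) ha
          simpa [hsmul] using hτ
      exact Subtype.ext (congrFun hzero σ)
    refine ⟨hli, hli.span_eq_top_of_card_eq_finrank' ?_⟩
    rw [← Nat.card_eq_fintype_card, IsGalois.card_aut_eq_finrank]
end
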